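/- Let d_i = ⌊2^(i−1)·√2⌋ mod 2 (i ≥ 1) be the binary digits of √2, and for each n ≥ 1 let w n be the non-standard vector representation of the first n digits, the vector in EuclideanSpace ℝ (Fin (2^n − 1)) formed by concatenating, for k = 1, …, n, a block of 2^(n−k) coordinates all equal to d_k. Then for every n ≥ 1, ‖w n‖ = √(⌊2^(n−1)·√2⌋), and consequently ‖w n‖ → ∞ as n → ∞. -/

import Mathlib

open Real Filter

/-- The `i`-th binary digit of `√2` (for `i ≥ 1`): `d_i = ⌊2^(i-1)·√2⌋ mod 2`. -/
noncomputable def sqrtTwoDigit (i : ℕ) : ℝ :=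
  ((⌊(2 : ℝ) ^ (i - 1) * Real.sqrt 2⌋ % 2 : ℤ) : ℝ)

theorem Int.floor_two_mul_eq_add_emod (x : ℝ) : ⌊2 * x⌋ = 2 * ⌊x⌋ + ⌊2 * x⌋ % 2 := by
  have h := Int.floor_div_natCast (2 * x) 2
  rw [Nat.cast_ofNat, Nat.cast_ofNat, mul_div_cancel_left₀ _ two_ne_zero] at h
  omega

theorem sqrtTwoDigit_sq (i : ℕ) : sqrtTwoDigit i ^ 2 = sqrtTwoDigit i := by
  unfold sqrtTwoDigit
  rcases Int.emod_two_eq_zero_or_one ⌊(2 : ℝ) ^ (i - 1) * Real.sqrt 2⌋ with h | h <;> simp [h]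

theorem floor_sqrt_two : ⌊Real.sqrt 2⌋ = 1 := by
  have h := Real.floor_real_sqrt_eq_nat_sqrt (a := 2)
  rw [Nat.cast_ofNat] at h
  rw [h]
  norm_num

theorem sqrtTwoDigit_one : sqrtTwoDigit 1 = 1 := by
  simp [sqrtTwoDigit, floor_sqrt_two]

theorem floor_two_pow_mul_sqrt_two_succ {k : ℕ} (hk : 1 ≤ k) :
    (⌊(2 : ℝ) ^ k * Real.sqrt 2⌋ : ℝ) =
      2 * (⌊(2 : ℝ) ^ (k - 1) * Real.sqrt 2⌋ : ℝ) + sqrtTwoDigit (k + 1) := by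
  have h := Int.floor_two_mul_eq_add_emod ((2 : ℝ) ^ (k - 1) * Real.sqrt 2)
  rw [← mul_assoc, mul_pow_sub_one (by omega)] at h
  simp only [sqrtTwoDigit, Nat.add_sub_cancel]
  exact_mod_cast h

theorem sum_Icc_two_pow_sub_add {n k : ℕ} (hk : k ≤ n) :
    (∑ m ∈ Finset.Icc 1 k, 2 ^ (n - m)) + 2 ^ (n - k) = 2 ^ n := by
  induction k with
  | zero => simp
  | succ k ih =>
    rw [Finset.sum_Icc_succ_top (by omega), ← ih (by omega), add_assoc, ← two_mul, ← pow_succ',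
      show n - (k + 1) + 1 = n - k by omega]

theorem sum_range_sq_of_blocks {n : ℕ} (f : ℕ → ℝ)
    (hf : ∀ k, 1 ≤ k → k ≤ n → ∀ j, (∑ m ∈ Finset.Icc 1 (k - 1), 2 ^ (n - m)) ≤ j →
      j < ∑ m ∈ Finset.Icc 1 k, 2 ^ (n - m) → f j = sqrtTwoDigit k)
    {k : ℕ} (hk : 1 ≤ k) (hkn : k ≤ n) :
    ∑ j ∈ Finset.range (∑ m ∈ Finset.Icc 1 k, 2 ^ (n - m)), f j ^ 2 =
      2 ^ (n - k) * (⌊(2 : ℝ) ^ (k - 1) * Real.sqrt 2⌋ : ℝ) := by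
  have block : ∀ k, k + 1 ≤ n →
      ∑ j ∈ Finset.range (∑ m ∈ Finset.Icc 1 (k + 1), 2 ^ (n - m)), f j ^ 2 =
      ∑ j ∈ Finset.range (∑ m ∈ Finset.Icc 1 k, 2 ^ (n - m)), f j ^ 2 +
        2 ^ (n - (k + 1)) * sqrtTwoDigit (k + 1) := by
    intro k hkn
    have hS := Finset.sum_Icc_succ_top (show 1 ≤ k + 1 by omega) (fun m => 2 ^ (n - m))
    rw [hS, Finset.sum_range_add]
    congr 1
    rw [Finset.sum_congr rfl (g := fun _ => sqrtTwoDigit (k + 1))]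
    · simp
    · intro j hj
      rw [hf (k + 1) (by omega) hkn _ (by simp) (by rw [hS]; simpa using hj), sqrtTwoDigit_sq]
  induction k, hk using Nat.le_induction with
  | base =>
    rw [block 0 hkn]
    simp [floor_sqrt_two, sqrtTwoDigit_one]
  | succ k hk ih =>
    rw [block k hkn, ih (by omega), Nat.add_sub_cancel, floor_two_pow_mul_sqrt_two_succ hk,
      show n - k = n - (k + 1) + 1 by omega]
    ring

theorem tendsto_sqrt_floor_two_pow_mul_sqrt_two :
    Tendsto (fun n : ℕ => Real.sqrt ((⌊(2 : ℝ) ^ (n - 1) * Real.sqrt 2⌋ : ℤ) : ℝ))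
      atTop atTop := by
  have h : Tendsto (fun n : ℕ => (2 : ℝ) ^ (n - 1) * Real.sqrt 2) atTop atTop :=
    ((tendsto_pow_atTop_atTop_of_one_lt one_lt_two).comp
      (tendsto_sub_atTop_nat 1)).atTop_mul_const (by positivity)
  exact Real.tendsto_sqrt_atTop.comp
    (tendsto_intCast_atTop_atTop.comp (tendsto_floor_atTop.comp h))

/-- For each `n ≥ 1`, let `w n` be the non-standard vector representation in
`ℝ^(2^n - 1)` of the first `n` binary digits of `√2`: for `k = 1, …, n`, block `k`
consists of the `2^(n-k)` coordinates at positions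
`∑_{m=1}^{k-1} 2^(n-m) ≤ j < ∑_{m=1}^{k} 2^(n-m)`, all equal to `d_k`.  Then
`‖w n‖ = √(⌊2^(n-1)·√2⌋)` for every `n ≥ 1`, and consequently `‖w n‖ → ∞`. -/
theorem stmt_10 (w : (n : ℕ) → EuclideanSpace ℝ (Fin (2 ^ n - 1)))
    (hw : ∀ n, 1 ≤ n → ∀ k, 1 ≤ k → k ≤ n → ∀ j : Fin (2 ^ n - 1),
      (∑ m ∈ Finset.Icc 1 (k - 1), 2 ^ (n - m)) ≤ (j : ℕ) →
      (j : ℕ) < ∑ m ∈ Finset.Icc 1 k, 2 ^ (n - m) →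
      w n j = sqrtTwoDigit k) :
    (∀ n, 1 ≤ n →
      ‖w n‖ = Real.sqrt ((⌊(2 : ℝ) ^ (n - 1) * Real.sqrt 2⌋ : ℤ) : ℝ)) ∧
    Tendsto (fun n : ℕ => ‖w n‖) atTop atTop := by
  have norm_eq : ∀ n, 1 ≤ n →
      ‖w n‖ = Real.sqrt ((⌊(2 : ℝ) ^ (n - 1) * Real.sqrt 2⌋ : ℤ) : ℝ) := by
    intro n hn
    have hS := sum_Icc_two_pow_sub_add (le_refl n)
    rw [Nat.sub_self, pow_zero] at hS
    have hS' : ∑ m ∈ Finset.Icc 1 n, 2 ^ (n - m) = 2 ^ n - 1 := by omega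
    let f : ℕ → ℝ := fun j => if h : j < 2 ^ n - 1 then w n ⟨j, h⟩ else 0
    have hf : ∀ k, 1 ≤ k → k ≤ n → ∀ j, (∑ m ∈ Finset.Icc 1 (k - 1), 2 ^ (n - m)) ≤ j →
        j < ∑ m ∈ Finset.Icc 1 k, 2 ^ (n - m) → f j = sqrtTwoDigit k := by
      intro k hk hkn j hj hj'
      have hlt : j < 2 ^ n - 1 := by
        have := sum_Icc_two_pow_sub_add hkn
        have := Nat.one_le_two_pow (n := n - k)
        omega
      simp only [f, dif_pos hlt]
      exact hw n hn k hk hkn ⟨j, hlt⟩ hj hj'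
    have key := sum_range_sq_of_blocks f hf hn le_rfl
    rw [hS', Finset.sum_range, Nat.sub_self, pow_zero, one_mul] at key
    rw [EuclideanSpace.norm_eq, ← key]
    simp [f]
  exact ⟨norm_eq, tendsto_sqrt_floor_two_pow_mul_sqrt_two.congr'
    ((eventually_ge_atTop 1).mono fun n hn => (norm_eq n hn).symm)⟩
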